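/- arXiv:2403.05355 — 2 statements merged into one kernel-verified Lean document; each statement's English description precedes it below -/
import Mathlib

section
/- The total number of minimally dependent subsets of χ equals ∑_{k=2}^{r} (∏_{i=1}^{k} (2^r − 2^{i−1}))/(k+1)!, where each summand ∏_{i=1}^{k} (2^r − 2^{i−1})/(k+1)! is a natural number (the division is exact). (This is the number of relations in the paper's minimal presentation of the representation-graded Bredon homology ring of an elementary abelian 2-group of rank r.) -/
open MvPolynomial

/-- The rank-`r` elementary abelian 2-group's character vector space `W = F₂^r`. -/
abbrev W (r : ℕ) : Type := Fin r → ZMod 2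

/-- The set of nonzero vectors of `W r` (nontrivial characters). -/
abbrev Chi (r : ℕ) : Type := {w : W r // w ≠ 0}

/-- A finite set of nonzero vectors is minimally dependent if it is linearly dependent
but every proper subset is linearly independent. -/
def MinDep {r : ℕ} (T : Finset (Chi r)) : Prop :=
  (¬ LinearIndependent (ZMod 2) (fun x : (T : Set (Chi r)) => (x : Chi r).val)) ∧
  ∀ S : Finset (Chi r), S ⊂ T →
    LinearIndependent (ZMod 2) (fun x : (S : Set (Chi r)) => (x : Chi r).val)

/-- Over `F₂`, linear independence means that no nonempty subfamily sums to zero. -/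
theorem linearIndepOn_zmod_two_iff {ι V : Type*} [AddCommGroup V] [Module (ZMod 2) V]
    (v : ι → V) (s : Finset ι) :
    LinearIndepOn (ZMod 2) v (s : Set ι) ↔ ∀ t ⊆ s, ∑ i ∈ t, v i = 0 → t = ∅ := by
  classical
  rw [linearIndepOn_finset_iff]
  constructor
  · intro h t hts ht
    have h1 := h (fun i => if i ∈ t then 1 else 0) (by
      simp only [ite_smul, one_smul, zero_smul, ← Finset.sum_filter]
      rwa [Finset.filter_mem_eq_inter, Finset.inter_eq_right.2 hts])
    refine Finset.eq_empty_of_forall_notMem fun i hi => ?_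
    simpa [hi] using h1 i (hts hi)
  · intro h f hf i hi
    have h1 := h (s.filter fun i => f i ≠ 0) (Finset.filter_subset _ _) (by
      refine Eq.trans ?_ hf
      rw [Finset.sum_filter]
      refine Finset.sum_congr rfl fun j _ => ?_
      by_cases hj : f j = 0
      · simp [hj]
      · simp [(by decide : ∀ a : ZMod 2, a ≠ 0 → a = 1) _ hj])
    by_contra hne
    exact Finset.notMem_empty i (h1 ▸ Finset.mem_filter.2 ⟨hi, hne⟩)

theorem linearIndependent_zmod_two_iff {ι V : Type*} [Fintype ι] [AddCommGroup V]
    [Module (ZMod 2) V] (v : ι → V) :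
    LinearIndependent (ZMod 2) v ↔ ∀ t : Finset ι, ∑ i ∈ t, v i = 0 → t = ∅ := by
  rw [← linearIndepOn_univ_iff, ← Finset.coe_univ, linearIndepOn_zmod_two_iff]
  simp

/-- A family is a circuit if the only subfamilies summing to zero are the empty one
and the whole one. -/
def IsCircuitFamily {ι V : Type*} [Fintype ι] [AddCommGroup V] (v : ι → V) : Prop :=
  ∀ t : Finset ι, ∑ i ∈ t, v i = 0 ↔ t = ∅ ∨ t = Finset.univ

theorem minDep_iff {r : ℕ} (T : Finset (Chi r)) :
    MinDep T ↔ T.Nonempty ∧ ∀ S ⊆ T, ∑ x ∈ S, x.val = 0 ↔ S = ∅ ∨ S = T := by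
  have key (S : Finset (Chi r)) := linearIndepOn_zmod_two_iff (fun x : Chi r => x.val) S
  constructor
  · rintro ⟨hdep, hind⟩
    have hmin : ∀ S ⊂ T, ∑ x ∈ S, x.val = 0 → S = ∅ := fun S hS =>
      (key S).1 (hind S hS) S subset_rfl
    obtain ⟨U, hUT, hU0, hU⟩ : ∃ U ⊆ T, ∑ x ∈ U, x.val = 0 ∧ U ≠ ∅ := by
      by_contra! hcon
      exact hdep ((key T).2 hcon)
    obtain rfl : U = T := by
      by_contra hne
      exact hU (hmin U (hUT.ssubset_of_ne hne) hU0)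
    refine ⟨Finset.nonempty_iff_ne_empty.2 hU, fun S hS => ⟨fun h0 => ?_, ?_⟩⟩
    · by_cases h : S = U
      · exact Or.inr h
      · exact Or.inl (hmin S (hS.ssubset_of_ne h) h0)
    · rintro (rfl | rfl)
      · simp
      · exact hU0
  · rintro ⟨hne, h⟩
    refine ⟨fun hind => ?_, fun S hS => (key S).2 fun t ht h0 => ?_⟩
    · exact hne.ne_empty ((key T).1 hind T subset_rfl ((h T subset_rfl).2 (Or.inr rfl)))
    · refine ((h t (ht.trans hS.subset)).1 h0).resolve_right ?_
      rintro rfl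
      exact hS.not_subset ht

theorem minDep_map_iff {r : ℕ} {ι : Type*} [Fintype ι] [Nonempty ι] (e : ι ↪ Chi r) :
    MinDep (Finset.univ.map e) ↔ IsCircuitFamily fun i => (e i).val := by
  classical
  rw [minDep_iff]
  constructor
  · rintro ⟨-, h⟩ t
    have := h (t.map e) (Finset.map_subset_map.2 (Finset.subset_univ t))
    simpa using this
  · intro h
    refine ⟨by simp, fun S hS => ?_⟩
    obtain ⟨t, -, rfl⟩ := Finset.subset_map_iff.1 hS
    simpa using h t

theorem MinDep.card_mem {r : ℕ} {T : Finset (Chi r)} (hT : MinDep T) :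
    3 ≤ T.card ∧ T.card ≤ r + 1 := by
  classical
  obtain ⟨⟨x, hx⟩, h⟩ := (minDep_iff T).1 hT
  constructor
  · by_contra! hlt
    have h0 := (h T subset_rfl).2 (Or.inr rfl)
    have hpos : 0 < T.card := Finset.card_pos.2 ⟨x, hx⟩
    obtain h1 | h2 : T.card = 1 ∨ T.card = 2 := by omega
    · obtain ⟨a, rfl⟩ := Finset.card_eq_one.1 h1
      exact a.2 (by simpa using h0)
    · obtain ⟨a, b, hab, rfl⟩ := Finset.card_eq_two.1 h2
      rw [Finset.sum_pair hab] at h0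
      refine hab (Subtype.ext ?_)
      rw [eq_neg_of_add_eq_zero_left h0, ZModModule.neg_eq_self]
  · have h1 := (hT.2 _ (Finset.erase_ssubset hx)).fintype_card_le_finrank
    simp only [Finset.coe_sort_coe, Fintype.card_coe, Finset.card_erase_of_mem hx,
      Module.finrank_fin_fun] at h1
    omega

theorem IsCircuitFamily.ne_zero {ι V : Type*} [Fintype ι] [AddCommGroup V] {v : ι → V}
    (hv : IsCircuitFamily v) (hcard : 1 < Fintype.card ι) (i : ι) : v i ≠ 0 := by
  intro h
  rcases (hv {i}).1 (by simpa using h) with h | h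
  · simp at h
  · have := congrArg Finset.card h
    simp at this
    omega

theorem IsCircuitFamily.injective {ι V : Type*} [Fintype ι] [AddCommGroup V]
    [Module (ZMod 2) V] {v : ι → V} (hv : IsCircuitFamily v) (hcard : 2 < Fintype.card ι) :
    Function.Injective v := by
  classical
  intro i j hij
  by_contra hne
  rcases (hv {i, j}).1 (by rw [Finset.sum_pair hne, hij, ZModModule.add_self]) with h | h
  · simp at h
  · have := congrArg Finset.card h
    rw [Finset.card_pair hne, Finset.card_univ] at this
    omega

theorem IsCircuitFamily.cons_sum_tail {k : ℕ} {V : Type*} [AddCommGroup V] [Module (ZMod 2) V]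
    {v : Fin (k + 1) → V} (hv : IsCircuitFamily v) :
    (Fin.cons (∑ i, Fin.tail v i) (Fin.tail v) : Fin (k + 1) → V) = v := by
  have h0 := (hv Finset.univ).2 (Or.inr rfl)
  rw [Fin.sum_univ_succ] at h0
  have h1 : v 0 = ∑ i, Fin.tail v i := by
    rw [eq_neg_of_add_eq_zero_left h0, ZModModule.neg_eq_self]
    rfl
  rw [← h1, Fin.cons_self_tail]

theorem IsCircuitFamily.linearIndependent_tail {k : ℕ} {V : Type*} [AddCommGroup V]
    [Module (ZMod 2) V] {v : Fin (k + 1) → V} (hv : IsCircuitFamily v) :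
    LinearIndependent (ZMod 2) (Fin.tail v) := by
  rw [linearIndependent_zmod_two_iff]
  intro t ht
  rcases (hv (t.map (Fin.succEmb k))).1 (by simpa [Fin.tail] using ht) with h | h
  · simpa using h
  · have : (0 : Fin (k + 1)) ∈ t.map (Fin.succEmb k) := h ▸ Finset.mem_univ _
    simp [Fin.succ_ne_zero] at this

theorem LinearIndependent.isCircuitFamily_cons_sum {k : ℕ} {V : Type*} [AddCommGroup V]
    [Module (ZMod 2) V] {f : Fin k → V} (hf : LinearIndependent (ZMod 2) f) :
    IsCircuitFamily (Fin.cons (∑ i, f i) f : Fin (k + 1) → V) := by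
  classical
  rw [linearIndependent_zmod_two_iff] at hf
  have hall : ∑ i, (Fin.cons (∑ i, f i) f : Fin (k + 1) → V) i = 0 := by
    simp [Fin.sum_univ_succ, ZModModule.add_self]
  have haux (t : Finset (Fin (k + 1))) (h0 : 0 ∉ t)
      (ht : ∑ i ∈ t, (Fin.cons (∑ i, f i) f : Fin (k + 1) → V) i = 0) : t = ∅ := by
    obtain ⟨u, rfl⟩ : ∃ u : Finset (Fin k), u.map (Fin.succEmb k) = t := by
      refine ⟨Finset.univ.filter fun i => i.succ ∈ t, ?_⟩
      ext i
      cases i using Fin.cases with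
      | zero => simp [h0, Fin.succ_ne_zero]
      | succ i => simp
    rw [hf u (by simpa using ht), Finset.map_empty]
  refine fun t => ⟨fun ht => ?_, ?_⟩
  · by_cases h0 : 0 ∈ t
    · right
      rw [← Finset.compl_eq_empty_iff]
      refine haux _ (by simpa using h0) ?_
      rw [← Finset.sum_add_sum_compl t, ht, zero_add] at hall
      exact hall
    · exact Or.inl (haux t h0 ht)
  · rintro (rfl | rfl)
    · simp
    · exact hall

/-- Adjoining the sum turns linearly independent `k`-tuples into circuits of length `k + 1`. -/
def linearIndependentEquivCircuit (r k : ℕ) (hk : 2 ≤ k) :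
    {f : Fin k → W r // LinearIndependent (ZMod 2) f} ≃
      {e : Fin (k + 1) ↪ Chi r // MinDep (Finset.univ.map e)} where
  toFun f :=
    have hc := f.2.isCircuitFamily_cons_sum
    have hcard : 2 < Fintype.card (Fin (k + 1)) := by simp; omega
    ⟨⟨fun i => ⟨_, hc.ne_zero (by omega) i⟩, fun _ _ h =>
        hc.injective hcard (congrArg Subtype.val h)⟩,
      (minDep_map_iff _).2 hc⟩
  invFun e := ⟨_, ((minDep_map_iff _).1 e.2).linearIndependent_tail⟩
  left_inv _ := rfl
  right_inv e := by
    refine Subtype.ext (DFunLike.ext _ _ fun i => Subtype.ext ?_)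
    exact congrFun ((minDep_map_iff _).1 e.2).cons_sum_tail i

theorem card_embedding_map_univ_eq {α : Type*} {n : ℕ} (T : Finset α) (hT : T.card = n) :
    Nat.card {e : Fin n ↪ α // Finset.univ.map e = T} = n.factorial := by
  classical
  have equiv : {e : Fin n ↪ α // Finset.univ.map e = T} ≃ (Fin n ↪ T) :=
    { toFun := fun e => ⟨fun i => ⟨e.1 i, e.2.subset (Finset.mem_map_of_mem _ (Finset.mem_univ i))⟩, fun _ _ h =>
        e.1.injective (congrArg Subtype.val h)⟩
      invFun := fun g => ⟨g.trans (Function.Embedding.subtype _), by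
        refine Finset.eq_of_subset_of_card_le (fun x hx => ?_) (by simp [hT])
        obtain ⟨i, -, rfl⟩ := Finset.mem_map.1 hx
        exact (g i).2⟩
      left_inv := fun _ => rfl
      right_inv := fun _ => rfl }
  rw [Nat.card_congr equiv, Nat.card_eq_fintype_card, Fintype.card_embedding_eq]
  simp [hT, Nat.descFactorial_self]

open Classical in
theorem factorial_mul_card_minDep (r k : ℕ) (hk : 2 ≤ k) (hkr : k ≤ r) :
    (k + 1).factorial * (Finset.univ.filter fun T : Finset (Chi r) =>
      MinDep T ∧ T.card = k + 1).card = ∏ i ∈ Finset.range k, (2 ^ r - 2 ^ i) := by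
  have h1 := card_linearIndependent (K := ZMod 2) (V := W r) (k := k) (by simpa using hkr)
  rw [Nat.card_congr (linearIndependentEquivCircuit r k hk)] at h1
  simp only [Module.finrank_fin_fun, ZMod.card] at h1
  rw [Finset.prod_range, ← h1, Nat.card_eq_fintype_card, Fintype.card_subtype,
    Finset.card_eq_sum_card_fiberwise (f := fun e => Finset.univ.map e)
      (t := Finset.univ.filter fun T : Finset (Chi r) => MinDep T ∧ T.card = k + 1)
      (fun e he => by simpa using he),
    Finset.sum_const_nat (m := (k + 1).factorial), mul_comm]
  intro T hT
  obtain ⟨hT, hcard⟩ := (Finset.mem_filter.1 hT).2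
  rw [← card_embedding_map_univ_eq T hcard, Nat.card_eq_fintype_card, Fintype.card_subtype,
    Finset.filter_filter]
  congr 1
  refine Finset.filter_congr fun e _ => ⟨And.right, ?_⟩
  rintro rfl
  exact ⟨hT, rfl⟩

/-- The total number of minimally dependent subsets of the nonzero vectors of `F₂^r`
equals `∑_{k=2}^{r} (∏_{i=1}^{k} (2^r - 2^(i-1)))/(k+1)!`, each division being exact. -/
theorem stmt6 (r : ℕ) :
    Set.ncard {T : Finset (Chi r) | MinDep T} =
      ∑ k ∈ Finset.Icc 2 r, (∏ i ∈ Finset.range k, (2 ^ r - 2 ^ i)) / Nat.factorial (k + 1) ∧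
    ∀ k ∈ Finset.Icc 2 r,
      Nat.factorial (k + 1) ∣ ∏ i ∈ Finset.range k, (2 ^ r - 2 ^ i) := by
  classical
  refine ⟨?_, fun k hk => ?_⟩
  · rw [Set.ncard_eq_toFinset_card', Finset.card_eq_sum_card_fiberwise
      (f := fun T => T.card - 1) (t := Finset.Icc 2 r)]
    · refine Finset.sum_congr rfl fun k hk => ?_
      obtain ⟨hk, hkr⟩ := Finset.mem_Icc.1 hk
      rw [← factorial_mul_card_minDep r k hk hkr,
        Nat.mul_div_cancel_left _ (Nat.factorial_pos _)]
      congr 1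
      ext T
      simp only [Finset.mem_filter, Set.mem_toFinset, Set.mem_ofPred_eq, Finset.mem_univ, true_and]
      refine and_congr_right fun hT => ?_
      have := hT.card_mem
      omega
    · intro T hT
      have hT' : MinDep T := by simpa using hT
      have := hT'.card_mem
      simp only [Finset.coe_Icc, Set.mem_Icc]
      omega
  · obtain ⟨hk, hkr⟩ := Finset.mem_Icc.1 hk
    exact ⟨_, (factorial_mul_card_minDep r k hk hkr).symm⟩
end

section
/- Let S ⊆ ι be a finite subset and let α, β, γ be three pairwise distinct elements of ι, none of which belongs to S. Then the identity a_γ · r(S ∪ {α,β}) = (a_α · t_β + t_α · a_β) · r(S ∪ {γ}) + r({α,β,γ}) · r(S) holds in the polynomial ring P over F₂. (This identity is used in the paper to show that the localized relations for minimally dependent sets of four or more characters are redundant.) -/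
open MvPolynomial

/-- The relation polynomial `r(T) = ∑_{λ∈T} a_λ ∏_{μ∈T\{λ}} t_μ` in
`P = F₂[a_i, t_i : i ∈ ι]`, with `a_i = X (Sum.inl i)` and `t_i = X (Sum.inr i)`. -/
noncomputable def rp {ι : Type*} [DecidableEq ι] (T : Finset ι) :
    MvPolynomial (ι ⊕ ι) (ZMod 2) :=
  ∑ lam ∈ T, X (Sum.inl lam) * ∏ mu ∈ T.erase lam, X (Sum.inr mu)

theorem rp_empty {ι : Type*} [DecidableEq ι] : rp (∅ : Finset ι) = 0 := by
  simp [rp]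

theorem rp_insert {ι : Type*} [DecidableEq ι] {T : Finset ι} {i : ι} (hi : i ∉ T) :
    rp (insert i T) =
      X (Sum.inl i) * ∏ mu ∈ T, X (Sum.inr mu) + X (Sum.inr i) * rp T := by
  unfold rp
  rw [Finset.sum_insert hi, Finset.erase_insert hi, Finset.mul_sum]
  congr 1
  refine Finset.sum_congr rfl fun j hj => ?_
  have hij : i ≠ j := fun h => hi (h ▸ hj)
  rw [Finset.erase_insert_of_ne hij,
    Finset.prod_insert fun h => hi (Finset.mem_of_mem_erase h)]
  ring

/-- The identity
`a_γ · r(S ∪ {α,β}) = (a_α t_β + t_α a_β) · r(S ∪ {γ}) + r({α,β,γ}) · r(S)`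
for pairwise distinct `α, β, γ` not belonging to `S`. -/
theorem stmt11 {ι : Type*} [DecidableEq ι] (S : Finset ι) (α β γ : ι)
    (hαβ : α ≠ β) (hαγ : α ≠ γ) (hβγ : β ≠ γ)
    (hα : α ∉ S) (hβ : β ∉ S) (hγ : γ ∉ S) :
    X (Sum.inl γ) * rp (S ∪ {α, β}) =
      (X (Sum.inl α) * X (Sum.inr β) + X (Sum.inr α) * X (Sum.inl β)) * rp (S ∪ {γ}) +
        rp {α, β, γ} * rp S := by
  have hpair : S ∪ {α, β} = insert α (insert β S) := by
    ext x
    simp only [Finset.mem_union, Finset.mem_insert, Finset.mem_singleton]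
    tauto
  have hsingle : S ∪ {γ} = insert γ S := by
    rw [Finset.union_comm, Finset.singleton_union]
  have htriple : rp {α, β, γ} =
      X (Sum.inl α) * (X (Sum.inr β) * X (Sum.inr γ)) +
        X (Sum.inr α) * (X (Sum.inl β) * X (Sum.inr γ) + X (Sum.inr β) * X (Sum.inl γ)) := by
    rw [rp_insert (by simp [hαβ, hαγ]), rp_insert (by simp [hβγ]), ← insert_empty_eq γ,
      rp_insert (Finset.notMem_empty γ), rp_empty]
    simp [Finset.prod_pair hβγ]
  rw [hpair, hsingle, htriple, rp_insert (by simp [hαβ, hα]), rp_insert hβ, rp_insert hγ,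
    Finset.prod_insert hβ]
  have htwo : (2 : MvPolynomial (ι ⊕ ι) (ZMod 2)) = 0 := CharTwo.two_eq_zero
  linear_combination
    (-(X (Sum.inl α) * X (Sum.inr β) + X (Sum.inr α) * X (Sum.inl β)) *
      X (Sum.inr γ) * rp S) * htwo
end
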